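/- arXiv:1710.09318 — 3 statements merged into one kernel-verified Lean document; each statement's English description precedes it below -/
import Mathlib

section
/- There exists ε > 0 such that for every r in the feasible rate region X and every pair (ρ*, λ*) with ρ* ≥ 0, λ* > 0, Γ_r(ρ*) = λ* ρ* and ‖ρ*‖_∞ = 1, one has λ* ≥ ε. -/
open Finset

/-- SINR of the link from base station `i` to test point `j`, given load vector `ρ`. -/
noncomputable def gamma (M N : ℕ) (p : Fin M → ℝ) (G : Fin M → Fin N → ℝ) (s2 : ℝ)
    (ρ : Fin M → ℝ) (i : Fin M) (j : Fin N) : ℝ :=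
  p i * G i j / ((∑ k ∈ Finset.univ.erase i, p k * G k j * ρ k) + s2)

/-- The load mapping `q(ρ, r)`; `serv j` is the (unique) base station serving test point `j`,
so that `N(i) = {j | serv j = i}`. -/
noncomputable def loadMap (M N : ℕ) (p : Fin M → ℝ) (G : Fin M → Fin N → ℝ) (s2 c : ℝ)
    (serv : Fin N → Fin M) (ρ : Fin M → ℝ) (r : Fin N → ℝ) : Fin M → ℝ :=
  fun i => (1 / c) * ∑ j ∈ Finset.univ.filter (fun j => serv j = i),
    r j / Real.log (1 + gamma M N p G s2 ρ i j)

/-- A rate vector `r > 0` is feasible if the load mapping `Γ_r` has a fixed point `ρ*`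
with `0 ≤ ρ* ≤ 1` componentwise. -/
def Feasible (M N : ℕ) (p : Fin M → ℝ) (G : Fin M → Fin N → ℝ) (s2 c : ℝ)
    (serv : Fin N → Fin M) (r : Fin N → ℝ) : Prop :=
  ∃ ρ : Fin M → ℝ, (∀ i, 0 ≤ ρ i) ∧ (∀ i, ρ i ≤ 1) ∧ loadMap M N p G s2 c serv ρ r = ρ

/-- The feasible rate region `X`. -/
def FeasRegion (M N : ℕ) (p : Fin M → ℝ) (G : Fin M → Fin N → ℝ) (s2 c : ℝ)
    (serv : Fin N → Fin M) (rmin : Fin N → ℝ) : Set (Fin N → ℝ) :=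
  {r | (∀ j, 0 < r j) ∧ (∀ j, rmin j ≤ r j) ∧ Feasible M N p G s2 c serv r}

/-- With nonnegative loads, the interference plus noise is at least the noise power. -/
theorem le_interference_add_noise {M N : ℕ} {p : Fin M → ℝ} (hp : ∀ i, 0 < p i)
    {G : Fin M → Fin N → ℝ} (hG : ∀ k j, 0 ≤ G k j) (s2 : ℝ)
    {ρ : Fin M → ℝ} (hρ : ∀ i, 0 ≤ ρ i) (i : Fin M) (j : Fin N) :
    s2 ≤ (∑ k ∈ Finset.univ.erase i, p k * G k j * ρ k) + s2 :=
  le_add_of_nonneg_left <| Finset.sum_nonneg fun k _ =>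
    mul_nonneg (mul_nonneg (hp k).le (hG k j)) (hρ k)

theorem gamma_nonneg {M N : ℕ} {p : Fin M → ℝ} (hp : ∀ i, 0 < p i)
    {G : Fin M → Fin N → ℝ} (hG : ∀ k j, 0 ≤ G k j) {s2 : ℝ} (hs2 : 0 < s2)
    {ρ : Fin M → ℝ} (hρ : ∀ i, 0 ≤ ρ i) (i : Fin M) (j : Fin N) :
    0 ≤ gamma M N p G s2 ρ i j :=
  div_nonneg (mul_nonneg (hp i).le (hG i j))
    (hs2.le.trans (le_interference_add_noise hp hG s2 hρ i j))

theorem gamma_pos {M N : ℕ} {p : Fin M → ℝ} (hp : ∀ i, 0 < p i)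
    {G : Fin M → Fin N → ℝ} (hG : ∀ k j, 0 ≤ G k j) {s2 : ℝ} (hs2 : 0 < s2)
    {ρ : Fin M → ℝ} (hρ : ∀ i, 0 ≤ ρ i) {i : Fin M} {j : Fin N} (hij : 0 < G i j) :
    0 < gamma M N p G s2 ρ i j :=
  div_pos (mul_pos (hp i) hij)
    (hs2.trans_le (le_interference_add_noise hp hG s2 hρ i j))

/-- The SINR is at most the signal-to-noise ratio. -/
theorem gamma_le_snr {M N : ℕ} {p : Fin M → ℝ} (hp : ∀ i, 0 < p i)
    {G : Fin M → Fin N → ℝ} (hG : ∀ k j, 0 ≤ G k j) {s2 : ℝ} (hs2 : 0 < s2)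
    {ρ : Fin M → ℝ} (hρ : ∀ i, 0 ≤ ρ i) (i : Fin M) (j : Fin N) :
    gamma M N p G s2 ρ i j ≤ p i * G i j / s2 :=
  div_le_div_of_nonneg_left (mul_nonneg (hp i).le (hG i j)) hs2
    (le_interference_add_noise hp hG s2 hρ i j)

/-- The load of a base station is at least the interference-free load caused by any one of its
test points. -/
theorem le_loadMap_serv {M N : ℕ} {p : Fin M → ℝ} (hp : ∀ i, 0 < p i)
    {G : Fin M → Fin N → ℝ} (hG : ∀ k j, 0 ≤ G k j) {s2 : ℝ} (hs2 : 0 < s2)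
    {c : ℝ} (hc : 0 < c) {serv : Fin N → Fin M} {ρ : Fin M → ℝ} (hρ : ∀ i, 0 ≤ ρ i)
    {r : Fin N → ℝ} (hr : ∀ j, 0 ≤ r j) {j : Fin N} (hj : 0 < G (serv j) j) :
    1 / c * (r j / Real.log (1 + p (serv j) * G (serv j) j / s2)) ≤
      loadMap M N p G s2 c serv ρ r (serv j) := by
  have hγ := gamma_pos hp hG hs2 hρ hj
  have hlog : Real.log (1 + gamma M N p G s2 ρ (serv j) j) ≤
      Real.log (1 + p (serv j) * G (serv j) j / s2) :=
    Real.log_le_log (by linarith) (by linarith [gamma_le_snr hp hG hs2 hρ (serv j) j])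
  refine mul_le_mul_of_nonneg_left ?_ (by positivity)
  refine (div_le_div_of_nonneg_left (hr j) (Real.log_pos (by linarith)) hlog).trans ?_
  exact Finset.single_le_sum
    (f := fun l => r l / Real.log (1 + gamma M N p G s2 ρ (serv j) l))
    (fun l _ => div_nonneg (hr l)
      (Real.log_nonneg (by linarith [gamma_nonneg hp hG hs2 hρ (serv j) l])))
    (by simp)

/-- The conditional eigenvalue `λ*` associated with feasible rate vectors
is uniformly bounded away from `0` over the feasible rate region. -/
theorem eigenvalue_bounded_away_from_zero
    {M N : ℕ} (hM : 0 < M) (hN : 0 < N)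
    (p : Fin M → ℝ) (hp : ∀ i, 0 < p i)
    (G : Fin M → Fin N → ℝ) (hG : ∀ k j, 0 ≤ G k j)
    (s2 : ℝ) (hs2 : 0 < s2) (c : ℝ) (hc : 0 < c)
    (serv : Fin N → Fin M) (hserv : ∀ j, 0 < G (serv j) j)
    (rmin : Fin N → ℝ) (hrmin : ∀ j, 0 < rmin j)
    (hXne : (FeasRegion M N p G s2 c serv rmin).Nonempty) :
    ∃ ε > (0 : ℝ), ∀ r ∈ FeasRegion M N p G s2 c serv rmin,
      ∀ (ρStar : Fin M → ℝ) (lamStar : ℝ),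
        (∀ i, 0 ≤ ρStar i) → 0 < lamStar →
        loadMap M N p G s2 c serv ρStar r = (fun i => lamStar * ρStar i) →
        ‖ρStar‖ = 1 → ε ≤ lamStar := by
  let j : Fin N := ⟨0, hN⟩
  have hsnr : 0 < p (serv j) * G (serv j) j / s2 :=
    div_pos (mul_pos (hp _) (hserv j)) hs2
  have hlog : 0 < Real.log (1 + p (serv j) * G (serv j) j / s2) :=
    Real.log_pos (by linarith)
  refine ⟨1 / c * (rmin j / Real.log (1 + p (serv j) * G (serv j) j / s2)),
    mul_pos (by positivity) (div_pos (hrmin j) hlog), ?_⟩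
  rintro r ⟨hr, hle, -⟩ ρ lam hρ hlam heq hnorm
  have hρ1 : ρ (serv j) ≤ 1 :=
    (Real.le_norm_self _).trans ((norm_le_pi_norm ρ (serv j)).trans hnorm.le)
  calc 1 / c * (rmin j / Real.log (1 + p (serv j) * G (serv j) j / s2))
      ≤ 1 / c * (r j / Real.log (1 + p (serv j) * G (serv j) j / s2)) := by
        gcongr
        exact hle j
    _ ≤ loadMap M N p G s2 c serv ρ r (serv j) :=
        le_loadMap_serv hp hG hs2 hc hρ (fun l => (hr l).le) (hserv j)
    _ = lam * ρ (serv j) := congrFun heq (serv j)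
    _ ≤ lam := mul_le_of_le_one_right hlam.le hρ1
end

section
/- Let f : X → ℝ^M be any function such that for every r ∈ X one has 0 ≤ f(r) ≤ 1 componentwise and Γ_r(f(r)) = f(r) (i.e., f maps each feasible rate vector to a fixed point of the associated load mapping). Then f is uniformly continuous on X. -/
open Finset

/-- Scaling the noise level `x` by `t ≥ 1` decreases the rate `log (1 + a / x)` by at most the
factor `t`. -/
theorem log_one_add_div_le_mul {a x y t : ℝ} (ha : 0 < a) (hx : 0 < x) (hy : 0 < y) (ht : 1 ≤ t)
    (hyx : y ≤ t * x) : Real.log (1 + a / x) ≤ t * Real.log (1 + a / y) := by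
  have hay : 0 < a / y := div_pos ha hy
  have hbernoulli : 1 + t * (a / y) ≤ (1 + a / y) ^ t :=
    one_add_mul_self_le_rpow_one_add (by linarith) ht
  have hratio : a / x ≤ t * (a / y) := by
    rw [← mul_div_assoc, div_le_div_iff₀ hx hy]
    nlinarith
  rw [← Real.log_rpow (by linarith)]
  exact Real.log_le_log (by positivity) (by linarith)

section LoadMap

variable {M N : ℕ} {p : Fin M → ℝ} {G : Fin M → Fin N → ℝ} {s2 c : ℝ} {serv : Fin N → Fin M}
  {ρ σ : Fin M → ℝ} {r s : Fin N → ℝ}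

theorem interference_nonneg (hp : ∀ i, 0 < p i) (hG : ∀ k j, 0 ≤ G k j) (hρ : ∀ i, 0 ≤ ρ i)
    (i : Fin M) (j : Fin N) : 0 ≤ ∑ k ∈ univ.erase i, p k * G k j * ρ k :=
  sum_nonneg fun k _ => mul_nonneg (mul_nonneg (hp k).le (hG k j)) (hρ k)

theorem interference_le_sum (hp : ∀ i, 0 < p i) (hG : ∀ k j, 0 ≤ G k j) (hρ1 : ∀ i, ρ i ≤ 1)
    (i : Fin M) (j : Fin N) :
    ∑ k ∈ univ.erase i, p k * G k j * ρ k ≤ ∑ l, ∑ k, p k * G k l := by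
  have hpG : ∀ k l, 0 ≤ p k * G k l := fun k l => mul_nonneg (hp k).le (hG k l)
  calc ∑ k ∈ univ.erase i, p k * G k j * ρ k
      ≤ ∑ k ∈ univ.erase i, p k * G k j :=
        sum_le_sum fun k _ => mul_le_of_le_one_right (hpG k j) (hρ1 k)
    _ ≤ ∑ k, p k * G k j :=
        sum_le_sum_of_subset_of_nonneg (erase_subset _ _) fun k _ _ => hpG k j
    _ ≤ ∑ l, ∑ k, p k * G k l :=
        single_le_sum (f := fun l => ∑ k, p k * G k l)
          (fun l _ => sum_nonneg fun k _ => hpG k l) (mem_univ j)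

theorem log_one_add_gamma_pos (hp : ∀ i, 0 < p i) (hG : ∀ k j, 0 ≤ G k j) (hs2 : 0 < s2)
    (hserv : ∀ j, 0 < G (serv j) j) (hρ : ∀ i, 0 ≤ ρ i) (j : Fin N) :
    0 < Real.log (1 + gamma M N p G s2 ρ (serv j) j) := by
  have hI := interference_nonneg hp hG hρ (serv j) j
  have : 0 < gamma M N p G s2 ρ (serv j) j :=
    div_pos (mul_pos (hp _) (hserv j)) (by linarith)
  exact Real.log_pos (by linarith)

/-- If the demands grow by at most the factor `u` and the interference plus noise by at most the
factor `t ≥ 1`, then the load grows by at most the factor `u * t`. -/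
theorem loadMap_le_mul (hp : ∀ i, 0 < p i) (hG : ∀ k j, 0 ≤ G k j) (hs2 : 0 < s2) (hc : 0 < c)
    (hserv : ∀ j, 0 < G (serv j) j) (hρ : ∀ i, 0 ≤ ρ i) (hσ : ∀ i, 0 ≤ σ i) (hs : ∀ j, 0 < s j)
    {u t : ℝ} (ht : 1 ≤ t) (hsr : ∀ j, s j ≤ u * r j)
    (i : Fin M) (hI : ∀ j, (∑ k ∈ univ.erase i, p k * G k j * σ k) + s2 ≤
      t * ((∑ k ∈ univ.erase i, p k * G k j * ρ k) + s2)) :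
    loadMap M N p G s2 c serv σ s i ≤ u * t * loadMap M N p G s2 c serv ρ r i := by
  unfold loadMap
  rw [mul_left_comm, mul_sum (a := u * t)]
  refine mul_le_mul_of_nonneg_left (sum_le_sum fun j hj => ?_) (by positivity)
  obtain rfl : serv j = i := by simpa using hj
  have hρpos := log_one_add_gamma_pos hp hG hs2 hserv hρ j
  have hσpos := log_one_add_gamma_pos hp hG hs2 hserv hσ j
  have hIρ := interference_nonneg hp hG hρ (serv j) j
  have hIσ := interference_nonneg hp hG hσ (serv j) j
  have hlog : Real.log (1 + gamma M N p G s2 ρ (serv j) j) ≤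
      t * Real.log (1 + gamma M N p G s2 σ (serv j) j) :=
    log_one_add_div_le_mul (mul_pos (hp _) (hserv j)) (by linarith) (by linarith) ht (hI j)
  rw [← mul_div_assoc, div_le_div_iff₀ hσpos hρpos]
  calc s j * Real.log (1 + gamma M N p G s2 ρ (serv j) j)
      ≤ (u * r j) * (t * Real.log (1 + gamma M N p G s2 σ (serv j) j)) :=
        mul_le_mul (hsr j) hlog hρpos.le ((hs j).le.trans (hsr j))
    _ = u * t * r j * Real.log (1 + gamma M N p G s2 σ (serv j) j) := by ring

/-- Quantitative comparison of fixed points of the load mapping for nearby rate vectors; `θ` bounds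
from below the share of the noise in the interference plus noise. -/
theorem fixedPoint_le_add (hp : ∀ i, 0 < p i) (hG : ∀ k j, 0 ≤ G k j) (hs2 : 0 < s2) (hc : 0 < c)
    (hserv : ∀ j, 0 < G (serv j) j) (hρ : ∀ i, 0 ≤ ρ i) (hρ1 : ∀ i, ρ i ≤ 1)
    (hσ : ∀ i, 0 ≤ σ i) (hσ1 : ∀ i, σ i ≤ 1) (hs : ∀ j, 0 < s j)
    (hρfix : loadMap M N p G s2 c serv ρ r = ρ) (hσfix : loadMap M N p G s2 c serv σ s = σ)
    {θ η : ℝ} (hθ : 0 < θ) (hθ1 : θ ≤ 1) (hη : 0 ≤ η) (hηθ : η ≤ θ / 2)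
    (hθI : ∀ i j, θ * ((∑ k ∈ univ.erase i, p k * G k j * ρ k) + s2) ≤ s2)
    (hsr : ∀ j, s j ≤ (1 + η) * r j) (i : Fin M) : σ i ≤ ρ i + 2 * η / θ := by
  have hslack : 0 ≤ 2 * η / θ := by positivity
  have hzero : ∀ k, ρ k = 0 → σ k = 0 := by
    intro k hk
    have hB : 0 ≤ (∑ l, ∑ k, p k * G k l) / s2 := div_nonneg
      (sum_nonneg fun l _ => sum_nonneg fun k _ => mul_nonneg (hp k).le (hG k l)) hs2.le
    have h := loadMap_le_mul (c := c) hp hG hs2 hc hserv hρ hσ hs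
      (le_add_of_nonneg_right hB) hsr k fun j => by
        have hIρ := interference_nonneg hp hG hρ k j
        have hIσ := interference_le_sum hp hG hσ1 k j
        rw [← div_mul_cancel₀ (∑ l, ∑ k, p k * G k l) hs2.ne'] at hIσ
        nlinarith [mul_nonneg hB hIρ]
    rw [hρfix, hσfix, hk, mul_zero] at h
    exact le_antisymm h (hσ k)
  obtain ⟨m, -, hm⟩ := exists_max_image univ (fun k => σ k / ρ k) ⟨i, mem_univ i⟩
  set α := σ m / ρ m with hα
  have hσα : ∀ k, σ k ≤ α * ρ k := by
    intro k
    rcases (hρ k).eq_or_lt with hk | hk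
    · rw [hzero k hk.symm, ← hk, mul_zero]
    · exact (div_le_iff₀ hk).1 (hm k (mem_univ k))
  rcases le_or_gt α 1 with hα1 | hα1
  · have := mul_le_of_le_one_left (hρ i) hα1
    linarith [hσα i]
  have hρm : 0 < ρ m := by
    refine (hρ m).lt_of_ne' fun h => ?_
    rw [hα, h, div_zero] at hα1
    linarith
  have hσm : σ m = α * ρ m := by rw [hα, div_mul_cancel₀ _ hρm.ne']
  have ht : 1 ≤ α - (α - 1) * θ := by nlinarith
  have h := loadMap_le_mul (c := c) hp hG hs2 hc hserv hρ hσ hs ht hsr m fun j => by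
    have hIle : ∑ k ∈ univ.erase m, p k * G k j * σ k ≤
        α * ∑ k ∈ univ.erase m, p k * G k j * ρ k := by
      rw [mul_sum]
      refine sum_le_sum fun k _ => ?_
      rw [mul_left_comm]
      exact mul_le_mul_of_nonneg_left (hσα k) (mul_nonneg (hp k).le (hG k j))
    nlinarith [mul_le_mul_of_nonneg_left (hθI m j) (sub_nonneg.2 hα1.le)]
  rw [hρfix, hσfix, hσm] at h
  have hαle : α ≤ (1 + η) * (α - (α - 1) * θ) := le_of_mul_le_mul_right h hρm
  have hα2 : α - 1 ≤ 2 * η / θ := by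
    rw [le_div_iff₀ hθ]
    nlinarith [mul_nonneg hη (mul_nonneg (sub_nonneg.2 hα1.le) hθ.le)]
  nlinarith [hσα i, hρ i, hρ1 i]

end LoadMap

/-- Any map sending each feasible rate vector to a fixed point of the
associated load mapping (with values in `[0,1]^M`) is uniformly continuous on `X`. -/
theorem fixedPoint_map_uniformContinuousOn
    {M N : ℕ} (hM : 0 < M) (hN : 0 < N)
    (p : Fin M → ℝ) (hp : ∀ i, 0 < p i)
    (G : Fin M → Fin N → ℝ) (hG : ∀ k j, 0 ≤ G k j)
    (s2 : ℝ) (hs2 : 0 < s2) (c : ℝ) (hc : 0 < c)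
    (serv : Fin N → Fin M) (hserv : ∀ j, 0 < G (serv j) j)
    (rmin : Fin N → ℝ) (hrmin : ∀ j, 0 < rmin j)
    (hXne : (FeasRegion M N p G s2 c serv rmin).Nonempty)
    (f : (Fin N → ℝ) → (Fin M → ℝ))
    (hf : ∀ r ∈ FeasRegion M N p G s2 c serv rmin,
      (∀ i, 0 ≤ f r i) ∧ (∀ i, f r i ≤ 1) ∧
      loadMap M N p G s2 c serv (f r) r = f r) :
    UniformContinuousOn f (FeasRegion M N p G s2 c serv rmin) := by
  set B := ∑ j, ∑ k, p k * G k j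
  have hB0 : 0 ≤ B := sum_nonneg fun j _ => sum_nonneg fun k _ => mul_nonneg (hp k).le (hG k j)
  set θ := s2 / (B + s2)
  have hθ : 0 < θ := by positivity
  have hθ1 : θ ≤ 1 := (div_le_one (by positivity)).2 (by linarith)
  have hθB : θ * (B + s2) = s2 := div_mul_cancel₀ _ (by positivity)
  obtain ⟨j₀, -, hj₀⟩ := exists_min_image univ rmin ⟨⟨0, hN⟩, mem_univ _⟩
  have hone_sided : ∀ η, 0 < η → η ≤ θ / 2 → ∀ r ∈ FeasRegion M N p G s2 c serv rmin,
      ∀ s ∈ FeasRegion M N p G s2 c serv rmin, (∀ j, s j ≤ r j + η * rmin j₀) →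
      ∀ i, f s i ≤ f r i + 2 * η / θ := by
    intro η hη hηθ r hr s hs hsr
    obtain ⟨hρ, hρ1, hρfix⟩ := hf r hr
    obtain ⟨hσ, hσ1, hσfix⟩ := hf s hs
    refine fixedPoint_le_add hp hG hs2 hc hserv hρ hρ1 hσ hσ1 hs.1 hρfix hσfix hθ hθ1 hη.le
      hηθ (fun i j => ?_) fun j => ?_
    · have := mul_le_mul_of_nonneg_left (interference_le_sum hp hG hρ1 i j) hθ.le
      linarith
    · have := mul_le_mul_of_nonneg_left ((hj₀ j (mem_univ j)).trans (hr.2.1 j)) hη.le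
      linarith [hsr j]
  rw [Metric.uniformContinuousOn_iff]
  intro ε hε
  obtain ⟨η, hη, hηθ, hηε⟩ : ∃ η, 0 < η ∧ η ≤ θ / 2 ∧ 2 * η / θ < ε := by
    refine ⟨min (θ / 2) (θ * ε / 4), by positivity, min_le_left _ _, ?_⟩
    rw [div_lt_iff₀ hθ]
    nlinarith [min_le_right (θ / 2) (θ * ε / 4), mul_pos hθ hε]
  refine ⟨η * rmin j₀, mul_pos hη (hrmin j₀), fun r hr s hs hrs => ?_⟩
  have hcoord : ∀ j, |r j - s j| ≤ η * rmin j₀ := fun j => (dist_le_pi_dist r s j).trans hrs.le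
  rw [dist_pi_lt_iff hε]
  intro i
  have h₁ := hone_sided η hη hηθ r hr s hs (fun j => by linarith [(abs_le.1 (hcoord j)).1]) i
  have h₂ := hone_sided η hη hηθ s hs r hr (fun j => by linarith [(abs_le.1 (hcoord j)).2]) i
  rw [Real.dist_eq, abs_lt]
  constructor <;> linarith
end

section
/- Assume X is closed under componentwise maxima, the data points x^1, …, x^K lie in X, and the data is compatible. Then the restrictions of σ_l and σ_u to X belong to F, and every f ∈ F satisfies σ_l(x) ≤ f(x) ≤ σ_u(x) for all x ∈ X; that is, σ_l and σ_u are the pointwise smallest and largest elements of F. -/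
/-- Componentwise positive part `(x)₊ = max(x, 0)`. -/
def posPartVec {n : ℕ} (x : Fin n → ℝ) : Fin n → ℝ := fun i => max (x i) 0

/-- Euclidean norm of a finitely-indexed real vector. -/
noncomputable def euclNorm {n : ℕ} (x : Fin n → ℝ) : ℝ :=
  Real.sqrt (∑ i, x i ^ 2)

/-- The lower envelope `σ_l(x) = max_k (ρ^k − L‖(x^k − x)₊‖)`. -/
noncomputable def sigLow {N K : ℕ} (xs : Fin K → Fin N → ℝ) (vals : Fin K → ℝ)
    (L : ℝ) (x : Fin N → ℝ) : ℝ :=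
  ⨆ k : Fin K, (vals k - L * euclNorm (posPartVec (xs k - x)))

/-- The upper envelope `σ_u(x) = min_k (ρ^k + L‖(x − x^k)₊‖)`. -/
noncomputable def sigUp {N K : ℕ} (xs : Fin K → Fin N → ℝ) (vals : Fin K → ℝ)
    (L : ℝ) (x : Fin N → ℝ) : ℝ :=
  ⨅ k : Fin K, (vals k + L * euclNorm (posPartVec (x - xs k)))

/-- The midpoint approximation `g = (σ_l + σ_u)/2`. -/
noncomputable def midApprox {N K : ℕ} (xs : Fin K → Fin N → ℝ) (vals : Fin K → ℝ)
    (L : ℝ) (x : Fin N → ℝ) : ℝ :=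
  (sigLow xs vals L x + sigUp xs vals L x) / 2

/-- A function is monotone on a set (componentwise order). -/
def MonotoneOnSet {n : ℕ} (f : (Fin n → ℝ) → ℝ) (X : Set (Fin n → ℝ)) : Prop :=
  ∀ x ∈ X, ∀ y ∈ X, (∀ i, x i ≤ y i) → f x ≤ f y

/-- A function is `L`-Lipschitz on a set with respect to the Euclidean norm. -/
def LipschitzOnSet {n : ℕ} (L : ℝ) (f : (Fin n → ℝ) → ℝ) (X : Set (Fin n → ℝ)) : Prop :=
  ∀ x ∈ X, ∀ y ∈ X, |f x - f y| ≤ L * euclNorm (x - y)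

/-- Membership in the class `F` of LIMF interpolants of the data: monotone on `X`,
`L`-Lipschitz on `X` (Euclidean norm), and interpolating the data. -/
def MemF {N K : ℕ} (X : Set (Fin N → ℝ)) (xs : Fin K → Fin N → ℝ) (vals : Fin K → ℝ)
    (L : ℝ) (f : (Fin N → ℝ) → ℝ) : Prop :=
  MonotoneOnSet f X ∧ LipschitzOnSet L f X ∧ ∀ k, f (xs k) = vals k

/-- Compatibility of the data with an `L`-Lipschitz monotone function. -/
def Compatible {N K : ℕ} (xs : Fin K → Fin N → ℝ) (vals : Fin K → ℝ) (L : ℝ) : Prop :=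
  ∀ k j, vals k - vals j ≤ L * euclNorm (posPartVec (xs k - xs j))

theorem euclNorm_eq_norm {n : ℕ} (x : Fin n → ℝ) : euclNorm x = ‖WithLp.toLp 2 x‖ := by
  simp [euclNorm, EuclideanSpace.norm_eq]

theorem euclNorm_add_le {n : ℕ} (x y : Fin n → ℝ) :
    euclNorm (x + y) ≤ euclNorm x + euclNorm y := by
  simpa only [euclNorm_eq_norm, WithLp.toLp_add] using
    norm_add_le (WithLp.toLp 2 x) (WithLp.toLp 2 y)

theorem euclNorm_sub_comm {n : ℕ} (x y : Fin n → ℝ) : euclNorm (x - y) = euclNorm (y - x) := by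
  simpa only [euclNorm_eq_norm, WithLp.toLp_sub] using
    norm_sub_rev (WithLp.toLp 2 x) (WithLp.toLp 2 y)

theorem euclNorm_mono {n : ℕ} {x y : Fin n → ℝ} (h : ∀ i, |x i| ≤ |y i|) :
    euclNorm x ≤ euclNorm y :=
  Real.sqrt_le_sqrt (Finset.sum_le_sum fun i _ => sq_le_sq.2 (h i))

theorem euclNorm_posPartVec_le {n : ℕ} (x : Fin n → ℝ) : euclNorm (posPartVec x) ≤ euclNorm x := by
  refine euclNorm_mono fun i => ?_
  rw [posPartVec, abs_of_nonneg (le_max_right _ _)]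
  exact max_le (le_abs_self _) (abs_nonneg _)

theorem euclNorm_posPartVec_eq_zero {n : ℕ} {x : Fin n → ℝ} (h : ∀ i, x i ≤ 0) :
    euclNorm (posPartVec x) = 0 := by
  simp [euclNorm, posPartVec, max_eq_right (h _)]

theorem euclNorm_posPartVec_sub_le {n : ℕ} (x y z : Fin n → ℝ) :
    euclNorm (posPartVec (x - z)) ≤
      euclNorm (posPartVec (x - y)) + euclNorm (posPartVec (y - z)) := by
  refine le_trans (euclNorm_mono fun i => ?_) (euclNorm_add_le _ _)
  simp only [posPartVec, Pi.add_apply, Pi.sub_apply]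
  have hxy := le_max_left (x i - y i) 0
  have hyz := le_max_left (y i - z i) 0
  have hxy₀ := le_max_right (x i - y i) 0
  have hyz₀ := le_max_right (y i - z i) 0
  rw [abs_of_nonneg (le_max_right _ _), abs_of_nonneg (add_nonneg hxy₀ hyz₀)]
  exact max_le (by linarith) (by linarith)

/-- A one-sided Lipschitz bound with respect to `‖(x - y)₊‖` gives both monotonicity and the
Lipschitz property. -/
theorem memF_of_sub_le {N K : ℕ} {X : Set (Fin N → ℝ)} {xs : Fin K → Fin N → ℝ}
    {vals : Fin K → ℝ} {L : ℝ} (hL : 0 ≤ L) {f : (Fin N → ℝ) → ℝ}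
    (hf : ∀ x y, f x - f y ≤ L * euclNorm (posPartVec (x - y)))
    (hvals : ∀ k, f (xs k) = vals k) : MemF X xs vals L f := by
  have hlip : ∀ x y, f x - f y ≤ L * euclNorm (x - y) := fun x y =>
    (hf x y).trans (mul_le_mul_of_nonneg_left (euclNorm_posPartVec_le _) hL)
  refine ⟨fun x _ y _ hxy => ?_, fun x _ y _ => abs_sub_le_iff.2 ⟨hlip x y, ?_⟩, hvals⟩
  · have h := hf x y
    rw [euclNorm_posPartVec_eq_zero (x := x - y) fun i => sub_nonpos.2 (hxy i), mul_zero] at h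
    exact sub_nonpos.1 h
  · rw [euclNorm_sub_comm]
    exact hlip y x

/-- On a set closed under componentwise maxima, monotone `L`-Lipschitz functions satisfy the
one-sided Lipschitz bound. -/
theorem MonotoneOnSet.sub_le {n : ℕ} {L : ℝ} {X : Set (Fin n → ℝ)} {f : (Fin n → ℝ) → ℝ}
    (hmono : MonotoneOnSet f X) (hlip : LipschitzOnSet L f X)
    (hXmax : ∀ x ∈ X, ∀ y ∈ X, (fun i => max (x i) (y i)) ∈ X)
    {x y : Fin n → ℝ} (hx : x ∈ X) (hy : y ∈ X) :
    f x - f y ≤ L * euclNorm (posPartVec (x - y)) := by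
  have hmax := hXmax x hx y hy
  have hle := hmono x hx _ hmax fun i => le_max_left _ _
  have hdist := (le_abs_self _).trans (hlip _ hmax y hy)
  have heq : (fun i => max (x i) (y i)) - y = posPartVec (x - y) := by
    funext i
    simp [posPartVec, ← max_sub_sub_right]
  rw [heq] at hdist
  linarith

theorem le_sigLow {N K : ℕ} (xs : Fin K → Fin N → ℝ) (vals : Fin K → ℝ) (L : ℝ)
    (x : Fin N → ℝ) (k : Fin K) :
    vals k - L * euclNorm (posPartVec (xs k - x)) ≤ sigLow xs vals L x :=
  le_ciSup (f := fun k => vals k - L * euclNorm (posPartVec (xs k - x)))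
    (Set.finite_range _).bddAbove k

theorem sigUp_le {N K : ℕ} (xs : Fin K → Fin N → ℝ) (vals : Fin K → ℝ) (L : ℝ)
    (x : Fin N → ℝ) (k : Fin K) :
    sigUp xs vals L x ≤ vals k + L * euclNorm (posPartVec (x - xs k)) :=
  ciInf_le (f := fun k => vals k + L * euclNorm (posPartVec (x - xs k)))
    (Set.finite_range _).bddBelow k

theorem sigLow_sub_le {N K : ℕ} [Nonempty (Fin K)] (xs : Fin K → Fin N → ℝ) (vals : Fin K → ℝ)
    {L : ℝ} (hL : 0 ≤ L) (x y : Fin N → ℝ) :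
    sigLow xs vals L x - sigLow xs vals L y ≤ L * euclNorm (posPartVec (x - y)) := by
  rw [sub_le_iff_le_add]
  refine ciSup_le fun k => ?_
  have hy := le_sigLow xs vals L y k
  have htri := mul_le_mul_of_nonneg_left (euclNorm_posPartVec_sub_le (xs k) x y) hL
  linarith

theorem sigUp_sub_le {N K : ℕ} [Nonempty (Fin K)] (xs : Fin K → Fin N → ℝ) (vals : Fin K → ℝ)
    {L : ℝ} (hL : 0 ≤ L) (x y : Fin N → ℝ) :
    sigUp xs vals L x - sigUp xs vals L y ≤ L * euclNorm (posPartVec (x - y)) := by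
  rw [sub_le_comm]
  refine le_ciInf fun k => ?_
  have hx := sigUp_le xs vals L x k
  have htri := mul_le_mul_of_nonneg_left (euclNorm_posPartVec_sub_le x y (xs k)) hL
  linarith

theorem Compatible.sigLow_apply {N K : ℕ} [Nonempty (Fin K)] {xs : Fin K → Fin N → ℝ}
    {vals : Fin K → ℝ} {L : ℝ} (h : Compatible xs vals L) (k : Fin K) :
    sigLow xs vals L (xs k) = vals k := by
  refine le_antisymm (ciSup_le fun j => by linarith [h j k]) ?_
  have hk := le_sigLow xs vals L (xs k) k
  rwa [euclNorm_posPartVec_eq_zero (by simp), mul_zero, sub_zero] at hk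

theorem Compatible.sigUp_apply {N K : ℕ} [Nonempty (Fin K)] {xs : Fin K → Fin N → ℝ}
    {vals : Fin K → ℝ} {L : ℝ} (h : Compatible xs vals L) (k : Fin K) :
    sigUp xs vals L (xs k) = vals k := by
  refine le_antisymm ?_ (le_ciInf fun j => by linarith [h k j])
  have hk := sigUp_le xs vals L (xs k) k
  rwa [euclNorm_posPartVec_eq_zero (by simp), mul_zero, add_zero] at hk

/-- Under closure under maxima and compatibility, `σ_l` and `σ_u`
(restricted to `X`) belong to `F`, and they are the pointwise smallest and largest
elements of `F`. -/
theorem envelopes_extremal_in_F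
    {N K : ℕ} (hN : 0 < N) (hK : 0 < K)
    (L : ℝ) (hL : 0 ≤ L)
    (X : Set (Fin N → ℝ))
    (hXmax : ∀ x ∈ X, ∀ y ∈ X, (fun i => max (x i) (y i)) ∈ X)
    (xs : Fin K → Fin N → ℝ) (vals : Fin K → ℝ)
    (hxs : ∀ k, xs k ∈ X)
    (hcomp : Compatible xs vals L) :
    MemF X xs vals L (sigLow xs vals L) ∧
    MemF X xs vals L (sigUp xs vals L) ∧
    (∀ f : (Fin N → ℝ) → ℝ, MemF X xs vals L f →
      ∀ x ∈ X, sigLow xs vals L x ≤ f x ∧ f x ≤ sigUp xs vals L x) := by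
  have : Nonempty (Fin K) := ⟨⟨0, hK⟩⟩
  refine ⟨memF_of_sub_le hL (sigLow_sub_le xs vals hL) hcomp.sigLow_apply,
    memF_of_sub_le hL (sigUp_sub_le xs vals hL) hcomp.sigUp_apply, ?_⟩
  rintro f ⟨hmono, hlip, hvals⟩ x hx
  refine ⟨ciSup_le fun k => ?_, le_ciInf fun k => ?_⟩
  · have h := hmono.sub_le hlip hXmax (hxs k) hx
    rw [hvals] at h
    linarith
  · have h := hmono.sub_le hlip hXmax hx (hxs k)
    rw [hvals] at h
    linarith
end
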